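/- Let γ > 1 and suppose T satisfies the Functional Correlation Bound with rate n^{−γ} for η-Hölder observables. Then there exists a constant C > 0 such that for every integer n ≥ 1 and every bounded η-Hölder observable v : M → ℝ with ∫_M v dμ = 0, one has ‖S_v(n)‖_{L^{2γ}(μ)} ≤ C n^{1/2} ‖v‖_η. -/

import Mathlib

open MeasureTheory Function

/-- `T` satisfies the Functional Correlation Bound with rate `n ^ (-γ)` for `η`-Hölder
observables: there is a constant `C₀ > 0` such that for all `0 ≤ p < q`, all monotone sequences
of times `n_0 ≤ ⋯ ≤ n_{q-1}`, and every bounded separately `η`-Hölder `G : M^q → ℝ`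
(with bound `Ginf` on `|G|` and separate Hölder constants `Gh i`), the correlation between
`G(T^{n_0}x, …, T^{n_{q-1}}x)` and the decoupled version (where the first `p` coordinates use
`x₀` and the remaining ones `x₁`) is at most
`C₀ (n_p - n_{p-1})^{-γ} (Ginf + ∑ i, Gh i)`. -/
def FunctionalCorrelationBound {M : Type*} [MetricSpace M] [MeasurableSpace M]
    (μ : Measure M) (T : M → M) (η γ : ℝ) : Prop :=
  ∃ C₀ : ℝ, 0 < C₀ ∧
    ∀ (q p : ℕ), p < q →
    ∀ n : ℕ → ℕ, Monotone n → n (p - 1) < n p →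
    ∀ G : (Fin q → M) → ℝ, Measurable G →
    ∀ Ginf : ℝ, 0 ≤ Ginf → (∀ x, |G x| ≤ Ginf) →
    ∀ Gh : Fin q → ℝ, (∀ i, 0 ≤ Gh i) →
    (∀ (i : Fin q) (x : Fin q → M) (y : M),
        |G x - G (Function.update x i y)| ≤ Gh i * dist (x i) y ^ η) →
    |(∫ x, G (fun i => T^[n i] x) ∂μ) -
        ∫ x₀, ∫ x₁, G (fun i => if (i : ℕ) < p then T^[n i] x₀ else T^[n i] x₁) ∂μ ∂μ|
      ≤ C₀ * ((n p : ℝ) - (n (p - 1) : ℝ)) ^ (-γ) * (Ginf + ∑ i, Gh i)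

/-- Mean value bound for real powers. -/
lemma rpow_sub_rpow_le {a b p : ℝ} (ha : 0 ≤ a) (hab : a ≤ b) (hp : 1 ≤ p) :
    b ^ p - a ^ p ≤ p * b ^ (p - 1) * (b - a) := by
  rcases (ha.trans hab).eq_or_lt with hb | hb
  · have : a = b := by linarith
    simp [this]
  have h := one_add_mul_self_le_rpow_one_add (s := a / b - 1) (by
    have : 0 ≤ a / b := by positivity
    linarith) hp
  rw [add_sub_cancel, Real.div_rpow ha hb.le, le_div_iff₀ (by positivity)] at h
  have e : b ^ p = b ^ (p - 1) * b := by
    rw [← Real.rpow_add_one hb.ne', sub_add_cancel]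
  have : (1 + p * (a / b - 1)) * b ^ p = b ^ p - p * b ^ (p - 1) * (b - a) := by
    rw [e]; field_simp; ring
  linarith

lemma abs_abs_rpow_sub_abs_rpow_le {s t B p : ℝ} (hs : |s| ≤ B) (ht : |t| ≤ B) (hp : 1 ≤ p) :
    |(|s| ^ p - |t| ^ p)| ≤ p * B ^ (p - 1) * |s - t| := by
  wlog h : |t| ≤ |s| generalizing s t
  · rw [abs_sub_comm, abs_sub_comm s t]
    exact this ht hs (le_of_not_ge h)
  rw [abs_of_nonneg (sub_nonneg.2 (Real.rpow_le_rpow (abs_nonneg _) h (by linarith)))]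
  refine (rpow_sub_rpow_le (abs_nonneg _) h hp).trans ?_
  have h1 : |s| ^ (p - 1) ≤ B ^ (p - 1) :=
    Real.rpow_le_rpow (abs_nonneg _) hs (by linarith)
  have h2 : |s| - |t| ≤ |s - t| := abs_sub_abs_le_abs_sub s t
  have h3 : 0 ≤ |s| - |t| := sub_nonneg.2 h
  have : 0 ≤ B := (abs_nonneg _).trans hs
  gcongr

lemma abs_add_rpow_le_add_cross (x y : ℝ) {p : ℝ} (hp : 1 ≤ p) :
    |x + y| ^ p ≤ |x| ^ p + |y| ^ p
      + p * 2 ^ (p - 1) * (|x| ^ (p - 1) * |y| + |x| * |y| ^ (p - 1)) := by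
  wlog h : |y| ≤ |x| generalizing x y
  · have := this y x (le_of_not_ge h)
    rw [add_comm x y]
    linarith
  have h0 : |x + y| ^ p ≤ (|x| + |y|) ^ p :=
    Real.rpow_le_rpow (abs_nonneg _) (abs_add_le x y) (by linarith)
  have h1 := rpow_sub_rpow_le (abs_nonneg x) (le_add_of_nonneg_right (abs_nonneg y)) hp
  have h2 : (|x| + |y|) ^ (p - 1) ≤ 2 ^ (p - 1) * |x| ^ (p - 1) := by
    rw [← Real.mul_rpow (by norm_num) (abs_nonneg _)]
    exact Real.rpow_le_rpow (by positivity) (by linarith) (by linarith)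
  rw [add_sub_cancel_left] at h1
  have h3 : p * (|x| + |y|) ^ (p - 1) * |y| ≤ p * (2 ^ (p - 1) * |x| ^ (p - 1)) * |y| := by
    gcongr
  have h4 : 0 ≤ |y| ^ p := by positivity
  have h5 : 0 ≤ p * 2 ^ (p - 1) * (|x| * |y| ^ (p - 1)) := by positivity
  linarith

lemma abs_add_rpow_le_of_pos (x y : ℝ) {p δ : ℝ} (hp : 0 ≤ p) (hδ : 0 < δ) :
    |x + y| ^ p ≤ (1 + δ) ^ p * |x| ^ p + (1 + δ⁻¹) ^ p * |y| ^ p := by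
  rw [← Real.mul_rpow (by positivity) (by positivity),
    ← Real.mul_rpow (by positivity) (by positivity)]
  have h0 : |x + y| ≤ |x| + |y| := abs_add_le x y
  rcases le_total |y| (δ * |x|) with h | h
  · have := Real.rpow_le_rpow (abs_nonneg _) (show |x + y| ≤ (1 + δ) * |x| by linarith) hp
    have h2 : 0 ≤ ((1 + δ⁻¹) * |y|) ^ p := by positivity
    linarith
  · have hx : |x| ≤ δ⁻¹ * |y| := by
      rw [inv_mul_eq_div, le_div_iff₀ hδ]; linarith
    have := Real.rpow_le_rpow (abs_nonneg _) (show |x + y| ≤ (1 + δ⁻¹) * |y| by linarith) hp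
    have h2 : 0 ≤ ((1 + δ) * |x|) ^ p := by positivity
    linarith

lemma rpow_sub_one_le {t R p : ℝ} (ht : 0 ≤ t) (hR : 0 < R) (hp : 1 ≤ p) :
    t ^ (p - 1) ≤ R⁻¹ * t ^ p + R ^ (p - 1) := by
  rcases le_total t R with h | h
  · have := Real.rpow_le_rpow ht h (show 0 ≤ p - 1 by linarith)
    have h2 : 0 ≤ R⁻¹ * t ^ p := by positivity
    linarith
  · have ht' : 0 < t := hR.trans_le h
    have e : t ^ p = t ^ (p - 1) * t := by
      rw [← Real.rpow_add_one ht'.ne', sub_add_cancel]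
    have h1 : 1 ≤ R⁻¹ * t := by rw [inv_mul_eq_div, le_div_iff₀ hR]; linarith
    have h2 : 0 ≤ R ^ (p - 1) := by positivity
    have h3 : t ^ (p - 1) * 1 ≤ t ^ (p - 1) * (R⁻¹ * t) := by gcongr
    rw [e]
    linarith

section
variable {M : Type*} [MeasurableSpace M]

lemma integrable_abs_rpow_of_bound (μ : Measure M) [IsProbabilityMeasure μ] {X : M → ℝ} {B s : ℝ}
    (hX : Measurable X) (hB : ∀ x, |X x| ≤ B) (hs : 0 ≤ s) :
    Integrable (fun x => |X x| ^ s) μ :=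
  Integrable.of_bound (by fun_prop) (B ^ s) (Filter.Eventually.of_forall fun x => by
    rw [Real.norm_of_nonneg (by positivity)]
    exact Real.rpow_le_rpow (abs_nonneg _) (hB x) hs)

lemma integral_abs_rpow_sub_one_le (μ : Measure M) [IsProbabilityMeasure μ] {X : M → ℝ}
    {B R p : ℝ} (hX : Measurable X) (hB : ∀ x, |X x| ≤ B) (hR : 0 < R) (hp : 1 ≤ p)
    (h : ∫ x, |X x| ^ p ∂μ ≤ R ^ p) : ∫ x, |X x| ^ (p - 1) ∂μ ≤ 2 * R ^ (p - 1) := by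
  have hi : ∀ s : ℝ, 0 ≤ s → Integrable (fun x => |X x| ^ s) μ := fun s hs =>
    integrable_abs_rpow_of_bound μ hX hB hs
  have h1 : ∫ x, |X x| ^ (p - 1) ∂μ ≤ ∫ x, (R⁻¹ * |X x| ^ p + R ^ (p - 1)) ∂μ :=
    integral_mono (hi _ (by linarith)) (((hi p (by linarith)).const_mul _).add
      (integrable_const _)) fun x => rpow_sub_one_le (abs_nonneg _) hR hp
  rw [integral_add ((hi p (by linarith)).const_mul _) (integrable_const _),
    integral_const_mul] at h1
  simp only [integral_const, probReal_univ, smul_eq_mul, one_mul] at h1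
  have e : R ^ p = R ^ (p - 1) * R := by
    rw [← Real.rpow_add_one hR.ne', sub_add_cancel]
  have h2 : R⁻¹ * ∫ x, |X x| ^ p ∂μ ≤ R⁻¹ * R ^ p := by gcongr
  have h3 : R⁻¹ * R ^ p = R ^ (p - 1) := by rw [e]; field_simp
  linarith

lemma integral_integral_abs_add_rpow_le (μ : Measure M) [IsProbabilityMeasure μ] {X Y : M → ℝ}
    {B R W p : ℝ} (hX : Measurable X) (hY : Measurable Y) (hXB : ∀ x, |X x| ≤ B)
    (hYB : ∀ x, |Y x| ≤ B) (hR : 0 < R) (hW : 0 < W) (hp : 1 ≤ p)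
    (hXR : ∫ x, |X x| ^ p ∂μ ≤ R ^ p) (hYR : ∫ x, |Y x| ^ p ∂μ ≤ R ^ p)
    (hXW : ∫ x, X x ^ 2 ∂μ ≤ W ^ 2) (hYW : ∫ x, Y x ^ 2 ∂μ ≤ W ^ 2) :
    ∫ x, ∫ y, |X x + Y y| ^ p ∂μ ∂μ ≤
      2 * R ^ p + 8 * (p * 2 ^ (p - 1)) * (R ^ (p - 1) * W) := by
  have hone : ∀ Z : M → ℝ, Measurable Z → (∀ x, |Z x| ≤ B) → ∫ x, Z x ^ 2 ∂μ ≤ W ^ 2 →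
      ∫ x, |Z x| ∂μ ≤ 2 * W := fun Z hZ hZB h => by
    have := integral_abs_rpow_sub_one_le μ (p := 2) hZ hZB hW (by norm_num) (by simpa using h)
    norm_num at this
    exact this
  have hiX : ∀ s : ℝ, 0 ≤ s → Integrable (fun x => |X x| ^ s) μ := fun s hs =>
    integrable_abs_rpow_of_bound μ hX hXB hs
  have hiY : ∀ s : ℝ, 0 ≤ s → Integrable (fun x => |Y x| ^ s) μ := fun s hs =>
    integrable_abs_rpow_of_bound μ hY hYB hs
  have hiX1 : Integrable (fun x => |X x|) μ := by simpa using hiX 1 (by norm_num)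
  have hiY1 : Integrable (fun x => |Y x|) μ := by simpa using hiY 1 (by norm_num)
  set D := p * (2 : ℝ) ^ (p - 1) with hD
  have hD0 : 0 ≤ D := by positivity
  have hp0 : 0 ≤ p := by linarith
  have hp1 : 0 ≤ p - 1 := by linarith
  have hB : 0 ≤ B := by
    obtain ⟨x⟩ := nonempty_of_isProbabilityMeasure μ
    exact (abs_nonneg _).trans (hXB x)
  have inner : ∀ x, ∫ y, |X x + Y y| ^ p ∂μ ≤ |X x| ^ p + ∫ y, |Y y| ^ p ∂μ
      + D * (|X x| ^ (p - 1) * ∫ y, |Y y| ∂μ + |X x| * ∫ y, |Y y| ^ (p - 1) ∂μ) := by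
    intro x
    have hint : Integrable (fun y => |X x + Y y| ^ p) μ :=
      integrable_abs_rpow_of_bound μ (by fun_prop)
        (fun y => (abs_add_le _ _).trans (add_le_add (hXB x) (hYB y))) hp0
    have h1 : Integrable (fun y => |X x| ^ p + |Y y| ^ p) μ :=
      (integrable_const _).add (hiY p hp0)
    have h2 : Integrable (fun y => |X x| ^ (p - 1) * |Y y|) μ := hiY1.const_mul _
    have h3 : Integrable (fun y => |X x| * |Y y| ^ (p - 1)) μ := (hiY _ hp1).const_mul _
    have h4 : Integrable (fun y => D * (|X x| ^ (p - 1) * |Y y|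
        + |X x| * |Y y| ^ (p - 1))) μ := (h2.add h3).const_mul D
    refine (integral_mono hint (h1.add h4)
      fun y => abs_add_rpow_le_add_cross (X x) (Y y) hp).trans_eq ?_
    simp only [Pi.add_apply]
    rw [integral_add h1 h4, integral_const_mul, integral_add h2 h3,
      integral_add (integrable_const _) (hiY p hp0), integral_const_mul, integral_const_mul]
    simp
  have h1 : Integrable (fun x => |X x| ^ p + ∫ y, |Y y| ^ p ∂μ) μ :=
    (hiX p hp0).add (integrable_const _)
  have h2 : Integrable (fun x => |X x| ^ (p - 1) * ∫ y, |Y y| ∂μ) μ := (hiX _ hp1).mul_const _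
  have h3 : Integrable (fun x => |X x| * ∫ y, |Y y| ^ (p - 1) ∂μ) μ := hiX1.mul_const _
  have h4 : Integrable (fun x => D * (|X x| ^ (p - 1) * ∫ y, |Y y| ∂μ
      + |X x| * ∫ y, |Y y| ^ (p - 1) ∂μ)) μ := (h2.add h3).const_mul D
  have outer : ∫ x, ∫ y, |X x + Y y| ^ p ∂μ ∂μ ≤ ∫ x, |X x| ^ p ∂μ + ∫ y, |Y y| ^ p ∂μ
      + D * ((∫ x, |X x| ^ (p - 1) ∂μ) * (∫ y, |Y y| ∂μ)
        + (∫ x, |X x| ∂μ) * ∫ y, |Y y| ^ (p - 1) ∂μ) := by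
    refine (integral_mono_of_nonneg (Filter.Eventually.of_forall fun x =>
      integral_nonneg fun y => by positivity) (h1.add h4)
      (Filter.Eventually.of_forall inner)).trans_eq ?_
    simp only [Pi.add_apply]
    rw [integral_add h1 h4, integral_const_mul, integral_add h2 h3,
      integral_add (hiX p hp0) (integrable_const _), integral_mul_const, integral_mul_const]
    simp
  have a1 := integral_abs_rpow_sub_one_le μ hX hXB hR hp hXR
  have a2 := integral_abs_rpow_sub_one_le μ hY hYB hR hp hYR
  have a3 := hone X hX hXB hXW
  have a4 := hone Y hY hYB hYW
  have c1 : (∫ x, |X x| ^ (p - 1) ∂μ) * (∫ y, |Y y| ∂μ) ≤ (2 * R ^ (p - 1)) * (2 * W) :=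
    mul_le_mul a1 a4 (integral_nonneg fun _ => abs_nonneg _) (by positivity)
  have c2 : (∫ x, |X x| ∂μ) * (∫ y, |Y y| ^ (p - 1) ∂μ) ≤ (2 * W) * (2 * R ^ (p - 1)) :=
    mul_le_mul a3 a2 (integral_nonneg fun _ => by positivity) (by positivity)
  have c3 : D * ((∫ x, |X x| ^ (p - 1) ∂μ) * (∫ y, |Y y| ∂μ)
        + (∫ x, |X x| ∂μ) * ∫ y, |Y y| ^ (p - 1) ∂μ) ≤ D * (8 * (R ^ (p - 1) * W)) := by
    gcongr
    linarith
  linarith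
end

lemma measurable_birkhoffSum {M : Type*} [MeasurableSpace M] {T : M → M} (hT : Measurable T) {v : M → ℝ} (hv : Measurable v)
    (n : ℕ) : Measurable (birkhoffSum T v n) := by
  unfold birkhoffSum
  exact Finset.measurable_sum _ fun i _ => hv.comp (hT.iterate i)

lemma abs_birkhoffSum_le {M : Type*} {T : M → M} {v : M → ℝ} (hv : ∀ x, |v x| ≤ 1) (n : ℕ) (x : M) :
    |birkhoffSum T v n x| ≤ n := by
  unfold birkhoffSum
  refine (Finset.abs_sum_le_sum_abs _ _).trans ?_
  refine (Finset.sum_le_sum fun i _ => hv _).trans ?_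
  simp

lemma MeasureTheory.MeasurePreserving.integral_comp_iterate {M : Type*} [MeasurableSpace M]
    {μ : Measure M} {T : M → M} (hT : MeasurePreserving T μ μ) {f : M → ℝ} (hf : Measurable f)
    (n : ℕ) : ∫ x, f (T^[n] x) ∂μ = ∫ x, f x ∂μ := by
  have hn := hT.iterate n
  conv_rhs => rw [← hn.map_eq]
  rw [integral_map hn.measurable.aemeasurable hf.aestronglyMeasurable]

section
variable {M : Type*} [MetricSpace M] [MeasurableSpace M]

/-- The functional correlation bound with an explicit constant. -/
def FCBWith (μ : Measure M) (T : M → M) (η γ C₀ : ℝ) : Prop :=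
  ∀ (q p : ℕ), p < q →
    ∀ n : ℕ → ℕ, Monotone n → n (p - 1) < n p →
    ∀ G : (Fin q → M) → ℝ, Measurable G →
    ∀ Ginf : ℝ, 0 ≤ Ginf → (∀ x, |G x| ≤ Ginf) →
    ∀ Gh : Fin q → ℝ, (∀ i, 0 ≤ Gh i) →
    (∀ (i : Fin q) (x : Fin q → M) (y : M),
        |G x - G (Function.update x i y)| ≤ Gh i * dist (x i) y ^ η) →
    |(∫ x, G (fun i => T^[n i] x) ∂μ) -
        ∫ x₀, ∫ x₁, G (fun i => if (i : ℕ) < p then T^[n i] x₀ else T^[n i] x₁) ∂μ ∂μ|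
      ≤ C₀ * ((n p : ℝ) - (n (p - 1) : ℝ)) ^ (-γ) * (Ginf + ∑ i, Gh i)

/-- Mean-zero observables bounded by one with `η`-Hölder constant one. -/
structure UnitHolderMeanZero (μ : Measure M) (η : ℝ) (v : M → ℝ) : Prop where
  bound : ∀ x, |v x| ≤ 1
  holder : ∀ x y, |v x - v y| ≤ dist x y ^ η
  mean : ∫ x, v x ∂μ = 0

lemma measurable_of_abs_sub_le_dist_rpow [BorelSpace M] {η : ℝ} (hη : 0 < η) {v : M → ℝ}
    (h : ∀ x y, |v x - v y| ≤ dist x y ^ η) : Measurable v := by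
  refine Continuous.measurable (continuous_iff_continuousAt.2 fun x => ?_)
  rw [ContinuousAt, tendsto_iff_dist_tendsto_zero]
  refine squeeze_zero (fun _ => dist_nonneg) (fun y => h y x) ?_
  have : Continuous fun y => dist y x ^ η :=
    (continuous_id.dist continuous_const).rpow_const fun _ => Or.inr hη.le
  simpa [Real.zero_rpow hη.ne'] using this.tendsto x

variable [BorelSpace M] {μ : Measure M} {T : M → M} {η γ C₀ : ℝ}
  {v : M → ℝ}

lemma UnitHolderMeanZero.abs_integral_mul_le (hT : MeasurePreserving T μ μ) (hη : 0 < η)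
    (hF : FCBWith μ T η γ C₀) (hv : UnitHolderMeanZero μ η v) {i j : ℕ} (hij : i < j) :
    |∫ x, v (T^[i] x) * v (T^[j] x) ∂μ| ≤ 3 * C₀ * ((j - i : ℕ) : ℝ) ^ (-γ) := by
  have hm := measurable_of_abs_sub_le_dist_rpow hη hv.holder
  have h := hF 2 1 (by norm_num) (fun k => if k = 0 then i else j)
    (monotone_nat_of_le_succ fun k => by rcases k with _ | k <;> simp [hij.le]) (by simpa using hij)
    (fun z => v (z 0) * v (z 1)) (by fun_prop) 1 zero_le_one
    (fun z => by
      rw [abs_mul]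
      exact mul_le_one₀ (hv.bound _) (abs_nonneg _) (hv.bound _))
    (fun _ => 1) (fun _ => zero_le_one) (by
      intro k z y
      have key : ∀ a b c : M, |v a * (v b - v c)| ≤ 1 * dist b c ^ η := fun a b c => by
        rw [abs_mul]
        exact mul_le_mul (hv.bound _) (hv.holder _ _) (abs_nonneg _) zero_le_one
      fin_cases k
      · have := key (z 1) (z 0) y
        simp only [Fin.zero_eta, Fin.isValue, Function.update_self, ne_eq, one_ne_zero,
          not_false_eq_true, Function.update_of_ne]
        convert this using 2
        ring
      · have := key (z 0) (z 1) y
        simp only [Fin.mk_one, Fin.isValue, Function.update_self, ne_eq, zero_ne_one,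
          not_false_eq_true, Function.update_of_ne]
        convert this using 2
        ring)
  have h0 : ∫ x, v (T^[j] x) ∂μ = 0 := by
    rw [hT.integral_comp_iterate hm, hv.mean]
  simp only [Fin.isValue, Fin.val_zero, Fin.val_one, if_true, one_ne_zero, if_false, lt_irrefl,
    zero_lt_one, integral_const_mul, h0, mul_zero, integral_zero, sub_zero, tsub_self,
    Finset.sum_const, Finset.card_univ, Fintype.card_fin, nsmul_eq_mul, mul_one] at h
  rw [Nat.cast_sub hij.le]
  refine h.trans_eq ?_
  push_cast
  ring

lemma UnitHolderMeanZero.integral_sq_birkhoffSum_le [IsProbabilityMeasure μ] (hT : MeasurePreserving T μ μ) (hη : 0 < η)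
    (hγ : 1 < γ) (hC₀ : 0 ≤ C₀) (hF : FCBWith μ T η γ C₀) (hv : UnitHolderMeanZero μ η v) (n : ℕ) :
    ∫ x, birkhoffSum T v n x ^ 2 ∂μ ≤ (1 + 6 * C₀ * ∑' k : ℕ, (k : ℝ) ^ (-γ)) * n := by
  have hm := measurable_of_abs_sub_le_dist_rpow hη hv.holder
  have hsum : Summable fun k : ℕ => (k : ℝ) ^ (-γ) := Real.summable_nat_rpow.2 (by linarith)
  induction n with
  | zero => simp [birkhoffSum]
  | succ n ih =>
    have hS := measurable_birkhoffSum hT.measurable hm n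
    have hvn : Measurable fun x => v (T^[n] x) := hm.comp (hT.measurable.iterate n)
    have hb : ∀ i x, |v (T^[i] x) * v (T^[n] x)| ≤ 1 := fun i x => by
      rw [abs_mul]
      exact mul_le_one₀ (hv.bound _) (abs_nonneg _) (hv.bound _)
    have i1 : Integrable (fun x => birkhoffSum T v n x ^ 2) μ :=
      Integrable.of_bound (by fun_prop) ((n : ℝ) ^ 2) (Filter.Eventually.of_forall fun x => by
        rw [Real.norm_of_nonneg (by positivity), ← sq_abs]
        exact pow_le_pow_left₀ (abs_nonneg _) (abs_birkhoffSum_le hv.bound n x) 2)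
    have i2 : ∀ i, Integrable (fun x => v (T^[i] x) * v (T^[n] x)) μ := fun i =>
      Integrable.of_bound ((hm.comp (hT.measurable.iterate i)).mul hvn).aestronglyMeasurable 1
        (Filter.Eventually.of_forall (hb i))
    have e : ∀ x, birkhoffSum T v (n + 1) x ^ 2 = birkhoffSum T v n x ^ 2
        + 2 * ∑ i ∈ Finset.range n, v (T^[i] x) * v (T^[n] x) + v (T^[n] x) * v (T^[n] x) := by
      intro x
      rw [birkhoffSum_succ, ← Finset.sum_mul]
      simp only [birkhoffSum]
      ring
    have i3 : Integrable (fun x => 2 * ∑ i ∈ Finset.range n, v (T^[i] x) * v (T^[n] x)) μ :=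
      (integrable_finsetSum _ fun i _ => i2 i).const_mul 2
    have i4 : Integrable (fun x => birkhoffSum T v n x ^ 2
        + 2 * ∑ i ∈ Finset.range n, v (T^[i] x) * v (T^[n] x)) μ := i1.add i3
    simp only [e]
    rw [integral_add i4 (i2 n), integral_add i1 i3, integral_const_mul,
      integral_finsetSum _ fun i _ => i2 i]
    have h1 : ∫ x, v (T^[n] x) * v (T^[n] x) ∂μ ≤ 1 := by
      refine (integral_mono (i2 n) (integrable_const 1) fun x => ?_).trans (by simp)
      exact (le_abs_self _).trans (hb n x)
    have h2 : ∑ i ∈ Finset.range n, ∫ x, v (T^[i] x) * v (T^[n] x) ∂μ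
        ≤ 3 * C₀ * ∑' k : ℕ, (k : ℝ) ^ (-γ) := by
      calc _ ≤ ∑ i ∈ Finset.range n, 3 * C₀ * ((n - i : ℕ) : ℝ) ^ (-γ) :=
            Finset.sum_le_sum fun i hi => (le_abs_self _).trans
              (hv.abs_integral_mul_le hT hη hF (Finset.mem_range.1 hi))
        _ = 3 * C₀ * ∑ i ∈ Finset.range n, ((n - i : ℕ) : ℝ) ^ (-γ) := by rw [Finset.mul_sum]
        _ ≤ 3 * C₀ * ∑' k : ℕ, (k : ℝ) ^ (-γ) := by
            refine mul_le_mul_of_nonneg_left ?_ (by positivity)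
            rw [← Finset.sum_image (s := Finset.range n) (g := fun i => n - i)
              (f := fun k : ℕ => (k : ℝ) ^ (-γ)) (by
                intro a ha b hb hab
                simp only [Finset.coe_range, Set.mem_Iio] at ha hb
                simp only at hab
                omega)]
            exact hsum.sum_le_tsum _ fun k _ => by positivity
    push_cast
    linarith

lemma UnitHolderMeanZero.integral_abs_birkhoffSum_add_rpow_le (hη : 0 < η)
    (hF : FCBWith μ T η γ C₀) (hv : UnitHolderMeanZero μ η v) {p : ℝ} (hp : 1 ≤ p) {h g m : ℕ}
    (hh : 1 ≤ h) (hm : 1 ≤ m) :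
    ∫ x, |birkhoffSum T v h x + birkhoffSum T v m (T^[h + g] x)| ^ p ∂μ ≤
      ∫ x, ∫ y, |birkhoffSum T v h x + birkhoffSum T v m (T^[h + g] y)| ^ p ∂μ ∂μ
        + C₀ * ((g : ℝ) + 1) ^ (-γ) * ((1 + p) * ((h + m : ℕ) : ℝ) ^ p) := by
  have hmeas := measurable_of_abs_sub_le_dist_rpow hη hv.holder
  have hB : ∀ z : Fin (h + m) → M, |∑ i, v (z i)| ≤ ((h + m : ℕ) : ℝ) := fun z =>
    (Finset.abs_sum_le_sum_abs _ _).trans ((Finset.sum_le_sum fun i _ => hv.bound _).trans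
      (by simp))
  have hpos : (0 : ℝ) < ((h + m : ℕ) : ℝ) := by exact_mod_cast (by omega : 0 < h + m)
  have key := hF (h + m) h (by omega) (fun i => if i < h then i else i + g)
    (fun a b hab => by dsimp only; split_ifs <;> omega)
    (by simp only [lt_irrefl, if_false]; split_ifs <;> omega)
    (fun z => |∑ i, v (z i)| ^ p) (by fun_prop) (((h + m : ℕ) : ℝ) ^ p) (by positivity)
    (fun z => by
      rw [abs_of_nonneg (by positivity)]
      exact Real.rpow_le_rpow (abs_nonneg _) (hB z) (by linarith))
    (fun _ => p * ((h + m : ℕ) : ℝ) ^ (p - 1)) (fun _ => by positivity) (by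
      intro i z y
      refine (abs_abs_rpow_sub_abs_rpow_le (hB _) (hB _) hp).trans ?_
      refine mul_le_mul_of_nonneg_left ?_ (by positivity)
      refine le_of_eq_of_le ?_ (hv.holder (z i) y)
      congr 1
      rw [← Finset.sum_sub_distrib, Finset.sum_eq_single i]
      · simp
      · intro j _ hj
        simp [hj]
      · simp)
  have e : ∀ x y : M, ∑ i : Fin (h + m), v (if (i : ℕ) < h
      then T^[if (i : ℕ) < h then (i : ℕ) else i + g] x
      else T^[if (i : ℕ) < h then (i : ℕ) else i + g] y)
      = birkhoffSum T v h x + birkhoffSum T v m (T^[h + g] y) := by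
    intro x y
    rw [Fin.sum_univ_add]
    simp only [Fin.val_castAdd, Fin.is_lt, if_true, Fin.val_natAdd,
      show ∀ i : Fin m, ¬ (h + (i : ℕ) < h) from fun i => by omega, if_false]
    simp only [birkhoffSum, Finset.sum_range, ← Function.iterate_add_apply]
    congr 1
    refine Finset.sum_congr rfl fun i _ => ?_
    rw [show h + (i : ℕ) + g = i + (h + g) by ring]
  have e' : ∀ x : M, ∑ i : Fin (h + m), v (T^[if (i : ℕ) < h then (i : ℕ) else i + g] x)
      = birkhoffSum T v h x + birkhoffSum T v m (T^[h + g] x) := fun x => by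
    simpa only [ite_self] using e x x
  simp only [e, e'] at key
  have hgap : (((if h < h then h else h + g : ℕ) : ℝ)
      - ((if h - 1 < h then h - 1 else h - 1 + g : ℕ) : ℝ)) = (g : ℝ) + 1 := by
    rw [if_neg (lt_irrefl _), if_pos (by omega), Nat.cast_sub hh]
    push_cast
    ring
  rw [hgap] at key
  have e2 : ((h + m : ℕ) : ℝ) ^ p + ∑ _i : Fin (h + m), p * ((h + m : ℕ) : ℝ) ^ (p - 1)
      = (1 + p) * ((h + m : ℕ) : ℝ) ^ p := by
    have : ((h + m : ℕ) : ℝ) ^ p = ((h + m : ℕ) : ℝ) ^ (p - 1) * ((h + m : ℕ) : ℝ) := by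
      rw [← Real.rpow_add_one hpos.ne', sub_add_cancel]
    rw [Finset.sum_const, Finset.card_univ, Fintype.card_fin, nsmul_eq_mul, this]
    ring
  rw [e2] at key
  linarith [le_abs_self ((∫ x, |birkhoffSum T v h x + birkhoffSum T v m (T^[h + g] x)| ^ p ∂μ) -
    ∫ x, ∫ y, |birkhoffSum T v h x + birkhoffSum T v m (T^[h + g] y)| ^ p ∂μ ∂μ)]
lemma exists_recursion_constants {γ : ℝ} (hγ : 1 < γ) (p E₁ E₂ : ℝ) :
    ∃ (δ : ℝ) (K : ℕ) (A : ℝ), 0 < δ ∧ 3 ≤ K ∧ (K : ℝ) ≤ A ∧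
      (1 + δ) ^ p * (2 * 2 ^ (-γ) * A + E₁ + E₂ * (K : ℝ) ^ γ)
        + (1 + δ⁻¹) ^ p * ((K : ℝ) ^ (-γ) * A) ≤ A := by
  have hρ : (2 : ℝ) * 2 ^ (-γ) < 1 := by
    have : (2 : ℝ) ^ (-γ) < 2 ^ (-1 : ℝ) := Real.rpow_lt_rpow_of_exponent_lt (by norm_num)
      (by linarith)
    rw [Real.rpow_neg_one] at this
    linarith
  obtain ⟨δ, hδ, hδρ⟩ : ∃ δ : ℝ, 0 < δ ∧ (1 + δ) ^ p * (2 * 2 ^ (-γ)) < 1 := by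
    have hc : ContinuousAt (fun δ : ℝ => (1 + δ) ^ p * (2 * 2 ^ (-γ))) 0 := by
      refine ContinuousAt.mul (ContinuousAt.rpow_const (by fun_prop) (Or.inl (by norm_num)))
        continuousAt_const
    have h1 := hc.eventually_lt (continuousAt_const (y := (1 : ℝ))) (by simpa using hρ)
    obtain ⟨δ, h, h'⟩ := ((h1.filter_mono nhdsWithin_le_nhds).and
      (self_mem_nhdsWithin (s := Set.Ioi (0 : ℝ)))).exists
    exact ⟨δ, h', h⟩
  set θ := (1 + δ) ^ p * (2 * 2 ^ (-γ)) with hθ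
  obtain ⟨K, hK3, hK⟩ : ∃ K : ℕ, 3 ≤ K ∧ (1 + δ⁻¹) ^ p * (K : ℝ) ^ (-γ) < (1 - θ) / 2 := by
    have h1 : Filter.Tendsto (fun K : ℕ => (1 + δ⁻¹) ^ p * (K : ℝ) ^ (-γ)) Filter.atTop
        (nhds ((1 + δ⁻¹) ^ p * 0)) :=
      ((tendsto_rpow_neg_atTop (by linarith)).comp tendsto_natCast_atTop_atTop).const_mul _
    rw [mul_zero] at h1
    obtain ⟨K, h, h'⟩ := ((Filter.eventually_ge_atTop 3).and
      (h1.eventually_lt_const (show 0 < (1 - θ) / 2 by linarith))).exists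
    exact ⟨K, h, h'⟩
  set F := (1 + δ) ^ p * (E₁ + E₂ * (K : ℝ) ^ γ) with hF
  refine ⟨δ, K, max K (F * 2 / (1 - θ)), hδ, hK3, le_max_left _ _, ?_⟩
  set A := max (K : ℝ) (F * 2 / (1 - θ))
  have hA0 : 0 ≤ A := (Nat.cast_nonneg K).trans (le_max_left _ _)
  have hA : F * 2 ≤ A * (1 - θ) := by
    rw [← div_le_iff₀ (by linarith)]
    exact le_max_right _ _
  have hKA := mul_le_mul_of_nonneg_right hK.le hA0
  have e : (1 + δ) ^ p * (2 * 2 ^ (-γ) * A + E₁ + E₂ * (K : ℝ) ^ γ)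
        + (1 + δ⁻¹) ^ p * ((K : ℝ) ^ (-γ) * A)
      = θ * A + F + (1 + δ⁻¹) ^ p * (K : ℝ) ^ (-γ) * A := by
    rw [hθ, hF]; ring
  rw [e]
  linarith

lemma exists_integral_abs_birkhoffSum_rpow_le [IsProbabilityMeasure μ]
    (hT : MeasurePreserving T μ μ) (hη : 0 < η) (hγ : 1 < γ) (hC₀ : 0 ≤ C₀)
    (hF : FCBWith μ T η γ C₀) :
    ∃ A : ℝ, 0 < A ∧ ∀ v : M → ℝ, UnitHolderMeanZero μ η v → ∀ n : ℕ,
      ∫ x, |birkhoffSum T v n x| ^ (2 * γ) ∂μ ≤ A ^ (2 * γ) * (n : ℝ) ^ γ := by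
  set p := 2 * γ with hp
  have hp1 : 1 ≤ p := by linarith
  set c := 1 + 6 * C₀ * ∑' k : ℕ, (k : ℝ) ^ (-γ) with hc
  have hc0 : 0 < c := by
    have : 0 ≤ ∑' k : ℕ, (k : ℝ) ^ (-γ) := tsum_nonneg fun k => by positivity
    positivity
  obtain ⟨δ, K, A, hδ, hK3, hKA, hrec⟩ := exists_recursion_constants hγ p
    (8 * (p * 2 ^ (p - 1)) * √c) (C₀ * (1 + p))
  have hK0 : (3 : ℝ) ≤ K := by exact_mod_cast hK3
  have hA1 : 1 ≤ A := by linarith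
  have hA0 : 0 < A := by linarith
  refine ⟨A, hA0, fun v hv n => ?_⟩
  have hvm := measurable_of_abs_sub_le_dist_rpow hη hv.holder
  have hSm := measurable_birkhoffSum hT.measurable hvm
  have hsq : ∀ t : ℝ, 0 ≤ t → √t ^ p = t ^ γ := fun t ht => by
    rw [Real.sqrt_eq_rpow, ← Real.rpow_mul ht]
    congr 1
    rw [hp]; ring
  induction n using Nat.strong_induction_on with
  | _ N ih =>
  have hNp : (N : ℝ) ^ p = (N : ℝ) ^ γ * (N : ℝ) ^ γ := by
    rw [← Real.rpow_add_of_nonneg (Nat.cast_nonneg N) (by linarith) (by linarith), hp, two_mul]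
  rcases lt_or_ge N K with hNK | hNK
  · calc ∫ x, |birkhoffSum T v N x| ^ p ∂μ ≤ ∫ _x, (N : ℝ) ^ p ∂μ :=
          integral_mono (integrable_abs_rpow_of_bound μ (hSm N) (abs_birkhoffSum_le hv.bound N)
            (by linarith)) (integrable_const _) fun x =>
            Real.rpow_le_rpow (abs_nonneg _) (abs_birkhoffSum_le hv.bound N x) (by linarith)
      _ = (N : ℝ) ^ γ * (N : ℝ) ^ γ := by simp [hNp]
      _ ≤ A ^ p * (N : ℝ) ^ γ := by
          refine mul_le_mul_of_nonneg_right ?_ (by positivity)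
          have h1 : (N : ℝ) ≤ A := le_trans (by exact_mod_cast hNK.le) hKA
          exact (Real.rpow_le_rpow (Nat.cast_nonneg N) h1 (by linarith)).trans
            (Real.rpow_le_rpow_of_exponent_le hA1 (by linarith))
  · have hN3 : 3 ≤ N := hK3.trans hNK
    have hNpos : (0 : ℝ) < N := by exact_mod_cast (by omega : 0 < N)
    obtain ⟨h, hh⟩ : ∃ h, h = N / 2 := ⟨_, rfl⟩
    obtain ⟨g, hg⟩ : ∃ g, g = N / K := ⟨_, rfl⟩
    have hg1 : 1 ≤ g := by rw [hg, Nat.le_div_iff_mul_le (by omega)]; omega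
    have hg3 : g ≤ N / 3 := hg ▸ Nat.div_le_div_left hK3 (by norm_num)
    obtain ⟨m, hm⟩ : ∃ m, N = h + g + m := ⟨N - (h + g), by omega⟩
    have hh1 : 1 ≤ h := by omega
    have hm1 : 1 ≤ m := by omega
    have hhN : (h : ℝ) ≤ N / 2 := by
      rw [le_div_iff₀ (by norm_num)]; exact_mod_cast (by omega : h * 2 ≤ N)
    have hmN : (m : ℝ) ≤ N / 2 := by
      rw [le_div_iff₀ (by norm_num)]; exact_mod_cast (by omega : m * 2 ≤ N)
    have hgN : (g : ℝ) ≤ N / K := hg ▸ Nat.cast_div_le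
    have hgN' : (N : ℝ) / K ≤ g + 1 := by
      rw [div_le_iff₀ (by linarith)]
      have := (Nat.div_lt_iff_lt_mul (show 0 < K by omega)).1 (Nat.lt_succ_self (N / K))
      rw [← hg] at this
      exact_mod_cast this.le
    set s := √((N : ℝ) / 2) with hs
    have hs0 : 0 < s := Real.sqrt_pos.2 (by linarith)
    have hsp : s ^ p = 2 ^ (-γ) * (N : ℝ) ^ γ := by
      rw [hs, hsq _ (by linarith), Real.div_rpow hNpos.le (by norm_num),
        Real.rpow_neg (by norm_num)]
      field_simp
    have hAe : A ^ p = A ^ (p - 1) * A := by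
      rw [← Real.rpow_add_one hA0.ne', sub_add_cancel]
    have hse : s ^ p = s ^ (p - 1) * s := by
      rw [← Real.rpow_add_one hs0.ne', sub_add_cancel]
    have hbase : ∀ k : ℕ, k < N → (k : ℝ) ≤ N / 2 →
        ∫ x, |birkhoffSum T v k x| ^ p ∂μ ≤ (A * s) ^ p := fun k hk hk2 => by
      rw [Real.mul_rpow hA0.le hs0.le, hs, hsq _ (by linarith)]
      refine (ih k hk).trans ?_
      have := Real.rpow_le_rpow (Nat.cast_nonneg k) hk2 (show 0 ≤ γ by linarith)
      gcongr
    have hvar : ∀ k : ℕ, (k : ℝ) ≤ N / 2 →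
        ∫ x, birkhoffSum T v k x ^ 2 ∂μ ≤ (√c * s) ^ 2 := fun k hk2 => by
      rw [mul_pow, Real.sq_sqrt hc0.le, hs, Real.sq_sqrt (by linarith)]
      exact (hv.integral_sq_birkhoffSum_le hT hη hγ hC₀ hF k).trans
        (mul_le_mul_of_nonneg_left hk2 hc0.le)
    have hSmT := (hSm m).comp (hT.measurable.iterate (h + g))
    have hgap := (hSm g).comp (hT.measurable.iterate h)
    have hkN : ∀ k, k ≤ N → ∀ x, |birkhoffSum T v k x| ≤ N := fun k hk x =>
      (abs_birkhoffSum_le hv.bound k x).trans (by exact_mod_cast hk)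
    have hprod := integral_integral_abs_add_rpow_le μ (R := A * s) (W := √c * s) (p := p)
      (hSm h) hSmT (hkN h (by omega)) (fun x => hkN m (by omega) _) (by positivity)
      (by positivity) hp1 (hbase h (by omega) hhN)
      ((hT.integral_comp_iterate (f := fun x => |birkhoffSum T v m x| ^ p)
        (by fun_prop) (h + g)).trans_le (hbase m (by omega) hmN)) (hvar h hhN)
      ((hT.integral_comp_iterate (f := fun x => birkhoffSum T v m x ^ 2)
        (by fun_prop) (h + g)).trans_le (hvar m hmN))
    have hdec := hv.integral_abs_birkhoffSum_add_rpow_le hη hF hp1 (g := g) hh1 hm1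
    have herr : C₀ * ((g : ℝ) + 1) ^ (-γ) * ((1 + p) * ((h + m : ℕ) : ℝ) ^ p)
        ≤ C₀ * (1 + p) * (K : ℝ) ^ γ * (N : ℝ) ^ γ := by
      have h1 : ((g : ℝ) + 1) ^ (-γ) ≤ ((N : ℝ) / K) ^ (-γ) :=
        Real.rpow_le_rpow_of_nonpos (by positivity) hgN' (by linarith)
      have h2 : ((h + m : ℕ) : ℝ) ^ p ≤ (N : ℝ) ^ p :=
        Real.rpow_le_rpow (Nat.cast_nonneg _) (by exact_mod_cast (by omega : h + m ≤ N))
          (by linarith)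
      have h3 : ((N : ℝ) / K) ^ (-γ) * (N : ℝ) ^ p = (K : ℝ) ^ γ * (N : ℝ) ^ γ := by
        rw [hNp, Real.rpow_neg (by positivity), Real.div_rpow hNpos.le (by linarith)]
        field_simp
      calc C₀ * ((g : ℝ) + 1) ^ (-γ) * ((1 + p) * ((h + m : ℕ) : ℝ) ^ p)
          ≤ C₀ * ((N : ℝ) / K) ^ (-γ) * ((1 + p) * (N : ℝ) ^ p) := by gcongr
        _ = C₀ * (1 + p) * (((N : ℝ) / K) ^ (-γ) * (N : ℝ) ^ p) := by ring
        _ = C₀ * (1 + p) * (K : ℝ) ^ γ * (N : ℝ) ^ γ := by rw [h3]; ring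
    have hZ : ∫ x, |birkhoffSum T v g (T^[h] x)| ^ p ∂μ ≤
        A ^ p * ((K : ℝ) ^ (-γ) * (N : ℝ) ^ γ) := by
      rw [hT.integral_comp_iterate (f := fun x => |birkhoffSum T v g x| ^ p) (by fun_prop)]
      refine (ih g (by omega)).trans (mul_le_mul_of_nonneg_left ?_ (by positivity))
      refine (Real.rpow_le_rpow (Nat.cast_nonneg g) hgN (by linarith)).trans_eq ?_
      rw [Real.div_rpow hNpos.le (by linarith), Real.rpow_neg (by linarith)]
      field_simp
    have hsplit : ∫ x, |birkhoffSum T v N x| ^ p ∂μ ≤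
        (1 + δ) ^ p * ∫ x, |birkhoffSum T v h x + birkhoffSum T v m (T^[h + g] x)| ^ p ∂μ
          + (1 + δ⁻¹) ^ p * ∫ x, |birkhoffSum T v g (T^[h] x)| ^ p ∂μ := by
      have i1 : Integrable (fun x =>
          |birkhoffSum T v h x + birkhoffSum T v m (T^[h + g] x)| ^ p) μ :=
        integrable_abs_rpow_of_bound μ ((hSm h).add hSmT)
          (fun x => (abs_add_le _ _).trans (add_le_add (hkN h (by omega) x)
            (hkN m (by omega) _))) (by linarith)
      have i2 : Integrable (fun x => |birkhoffSum T v g (T^[h] x)| ^ p) μ :=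
        integrable_abs_rpow_of_bound μ hgap (fun x => hkN g (by omega) _) (by linarith)
      rw [← integral_const_mul, ← integral_const_mul,
        ← integral_add (i1.const_mul _) (i2.const_mul _)]
      refine integral_mono (integrable_abs_rpow_of_bound μ (hSm N) (hkN N le_rfl) (by linarith))
        ((i1.const_mul _).add (i2.const_mul _)) fun x => ?_
      refine le_of_eq_of_le ?_ (abs_add_rpow_le_of_pos _ _ (by linarith) hδ)
      dsimp only
      rw [show birkhoffSum T v N x = birkhoffSum T v h x + birkhoffSum T v m (T^[h + g] x)
        + birkhoffSum T v g (T^[h] x) by rw [hm, birkhoffSum_add, birkhoffSum_add]; ring]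
    have hmain : ∫ x, |birkhoffSum T v h x + birkhoffSum T v m (T^[h + g] x)| ^ p ∂μ ≤
        A ^ (p - 1) * (N : ℝ) ^ γ * (2 * 2 ^ (-γ) * A + 8 * (p * 2 ^ (p - 1)) * √c
          + C₀ * (1 + p) * (K : ℝ) ^ γ) := by
      have hu : s ^ p ≤ (N : ℝ) ^ γ := by
        rw [hs, hsq _ (by linarith)]
        exact Real.rpow_le_rpow (by linarith) (by linarith) (by linarith)
      have e1 : (A * s) ^ p = A ^ (p - 1) * (N : ℝ) ^ γ * (2 ^ (-γ) * A) := by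
        rw [Real.mul_rpow hA0.le hs0.le, hsp, hAe]; ring
      have e2 : (A * s) ^ (p - 1) * (√c * s) = A ^ (p - 1) * s ^ p * √c := by
        rw [Real.mul_rpow hA0.le hs0.le, hse]; ring
      have h1 : A ^ (p - 1) * s ^ p * √c ≤ A ^ (p - 1) * (N : ℝ) ^ γ * √c := by gcongr
      have h2 : 8 * (p * 2 ^ (p - 1)) * (A ^ (p - 1) * s ^ p * √c) ≤
          8 * (p * 2 ^ (p - 1)) * (A ^ (p - 1) * (N : ℝ) ^ γ * √c) := by gcongr
      have h3 : 1 * (C₀ * (1 + p) * (K : ℝ) ^ γ * (N : ℝ) ^ γ) ≤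
          A ^ (p - 1) * (C₀ * (1 + p) * (K : ℝ) ^ γ * (N : ℝ) ^ γ) :=
        mul_le_mul_of_nonneg_right (Real.one_le_rpow hA1 (by linarith)) (by positivity)
      rw [e1, e2] at hprod
      simp only [Function.comp_apply] at hprod
      linarith
    have hAN : 0 ≤ A ^ (p - 1) * (N : ℝ) ^ γ := by positivity
    calc ∫ x, |birkhoffSum T v N x| ^ p ∂μ
        ≤ (1 + δ) ^ p * (A ^ (p - 1) * (N : ℝ) ^ γ * (2 * 2 ^ (-γ) * A
            + 8 * (p * 2 ^ (p - 1)) * √c + C₀ * (1 + p) * (K : ℝ) ^ γ))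
          + (1 + δ⁻¹) ^ p * (A ^ p * ((K : ℝ) ^ (-γ) * (N : ℝ) ^ γ)) := by
          refine hsplit.trans ?_
          gcongr
      _ = A ^ (p - 1) * (N : ℝ) ^ γ * ((1 + δ) ^ p * (2 * 2 ^ (-γ) * A
            + 8 * (p * 2 ^ (p - 1)) * √c + C₀ * (1 + p) * (K : ℝ) ^ γ)
          + (1 + δ⁻¹) ^ p * ((K : ℝ) ^ (-γ) * A)) := by rw [hAe]; ring
      _ ≤ A ^ (p - 1) * (N : ℝ) ^ γ * A := mul_le_mul_of_nonneg_left hrec hAN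
      _ = A ^ p * (N : ℝ) ^ γ := by rw [hAe]; ring

end

/-- **Theorem 2.5(a).** If `T` satisfies the Functional Correlation Bound with rate `n^{-γ}`,
`γ > 1`, then there is `C > 0` such that `‖S_v(n)‖_{L^{2γ}(μ)} ≤ C n^{1/2} ‖v‖_η` for all
`n ≥ 1` and all bounded `η`-Hölder mean-zero observables `v` (here `Vinf` bounds `|v|`,
`Vh` is an `η`-Hölder constant for `v`, and `Vinf + Vh` plays the role of `‖v‖_η`). -/
theorem stmt0 {M : Type*} [MetricSpace M] [MeasurableSpace M] [BorelSpace M]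
    (μ : Measure M) [IsProbabilityMeasure μ] (T : M → M) (hT : MeasurePreserving T μ μ)
    (η : ℝ) (hη0 : 0 < η) (hη1 : η ≤ 1) (γ : ℝ) (hγ : 1 < γ)
    (hFCB : FunctionalCorrelationBound μ T η γ) :
    ∃ C : ℝ, 0 < C ∧
      ∀ (n : ℕ), 1 ≤ n →
      ∀ (v : M → ℝ) (Vinf Vh : ℝ), 0 ≤ Vinf → 0 ≤ Vh →
        (∀ x, |v x| ≤ Vinf) →
        (∀ x y, |v x - v y| ≤ Vh * dist x y ^ η) →
        (∫ x, v x ∂μ) = 0 →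
        eLpNorm (fun x => ∑ i ∈ Finset.range n, v (T^[i] x)) (ENNReal.ofReal (2 * γ)) μ
          ≤ ENNReal.ofReal (C * (n : ℝ) ^ ((1 : ℝ) / 2) * (Vinf + Vh)) := by
  obtain ⟨C₀, hC₀, hF⟩ := hFCB
  obtain ⟨A, hA, hbound⟩ :=
    exists_integral_abs_birkhoffSum_rpow_le (C₀ := C₀) hT hη0 hγ hC₀.le hF
  refine ⟨A, hA, fun n _ v Vinf Vh hVinf hVh hb hh hmean => ?_⟩
  rcases (add_nonneg hVinf hVh).eq_or_lt with hL | hL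
  · have hv0 : ∀ x, v x = 0 := fun x =>
      abs_eq_zero.1 (le_antisymm ((hb x).trans (by linarith)) (abs_nonneg _))
    simp [hv0]
  set L := Vinf + Vh with hLdef
  have hw : UnitHolderMeanZero μ η fun x => v x / L := by
    refine ⟨fun x => ?_, fun x y => ?_, ?_⟩
    · rw [abs_div, abs_of_pos hL, div_le_one hL]
      linarith [hb x]
    · rw [← sub_div, abs_div, abs_of_pos hL, div_le_iff₀ hL, mul_comm]
      exact (hh x y).trans (mul_le_mul_of_nonneg_right (by linarith) (by positivity))
    · rw [integral_div, hmean, zero_div]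
  have hwm := measurable_of_abs_sub_le_dist_rpow hη0 hw.holder
  have hS := measurable_birkhoffSum hT.measurable hwm n
  have e : (fun x => ∑ i ∈ Finset.range n, v (T^[i] x))
      = fun x => L * birkhoffSum T (fun x => v x / L) n x := by
    funext x
    rw [birkhoffSum, Finset.mul_sum]
    exact Finset.sum_congr rfl fun i _ => by field_simp
  have hmem : MemLp (fun x => L * birkhoffSum T (fun x => v x / L) n x)
      (ENNReal.ofReal (2 * γ)) μ :=
    MemLp.of_bound (by fun_prop) (L * n) (Filter.Eventually.of_forall fun x => by
      rw [Real.norm_eq_abs, abs_mul, abs_of_pos hL]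
      exact mul_le_mul_of_nonneg_left (abs_birkhoffSum_le hw.bound n x) hL.le)
  have hγ0 : 0 < 2 * γ := by linarith
  rw [e, hmem.eLpNorm_eq_integral_rpow_norm (by simpa using hγ0) ENNReal.ofReal_ne_top,
    ENNReal.toReal_ofReal hγ0.le]
  refine ENNReal.ofReal_le_ofReal ?_
  rw [Real.rpow_inv_le_iff_of_pos (integral_nonneg fun x => by positivity) (by positivity) hγ0,
    Real.mul_rpow (by positivity) hL.le, Real.mul_rpow hA.le (by positivity),
    ← Real.rpow_mul (Nat.cast_nonneg n), show (1 : ℝ) / 2 * (2 * γ) = γ by ring]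
  simp only [Real.norm_eq_abs, abs_mul, abs_of_pos hL, Real.mul_rpow hL.le (abs_nonneg _),
    integral_const_mul]
  rw [mul_comm]
  exact mul_le_mul_of_nonneg_right (hbound _ hw n) (by positivity)
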